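/- arXiv:1506.08191 — 8 statements merged into one kernel-verified Lean document; each statement's English description precedes it below -/
import Mathlib

section
/- For every real number a > 0 and every real number z > 0, one has (a·ψ(z)/z²)/(1 + a·ψ(z)/z) ≤ max(a, 4/3)/2. -/
theorem aux_nonneg (f g : ℝ → ℝ) (h0 : f 0 = 0) (hd : ∀ x, HasDerivAt f (g x) x)
    (hf : ∀ x, 0 ≤ x → 0 ≤ g x) : ∀ x, 0 ≤ x → 0 ≤ f x := by
  intro x hx
  have hm : MonotoneOn f (Set.Ici 0) := by
    apply monotoneOn_of_deriv_nonneg (convex_Ici 0)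
    · exact fun y _ => (hd y).continuousAt.continuousWithinAt
    · exact fun y _ => (hd y).differentiableAt.differentiableWithinAt
    · intro y hy
      rw [interior_Ici] at hy
      rw [(hd y).deriv]
      exact hf y (le_of_lt hy)
  have := hm (Set.mem_Ici.2 le_rfl) (Set.mem_Ici.2 hx) hx
  rwa [h0] at this

theorem aux_quad (a b c d e k : ℝ) (x : ℝ) :
    HasDerivAt (fun z : ℝ => Real.exp z * (a * z ^ 2 + b * z + c) + (d * z ^ 2 + e * z + k))
      (Real.exp x * (a * x ^ 2 + (2 * a + b) * x + (b + c)) + (0 * x ^ 2 + 2 * d * x + e)) x := by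
  have q : ∀ a b c : ℝ, HasDerivAt (fun z : ℝ => a * z ^ 2 + b * z + c) (2 * a * x + b) x := by
    intro a b c
    have := ((((hasDerivAt_id x).pow 2).const_mul a).add
      ((hasDerivAt_id x).const_mul b)).add_const c
    refine this.congr_deriv ?_
    simp
    ring
  refine (((Real.hasDerivAt_exp x).mul (q a b c)).add (q d e k)).congr_deriv ?_
  ring

theorem aux_pos : ∀ z : ℝ, 0 ≤ z →
    0 ≤ Real.exp z * (2 * z ^ 2 + (-5) * z + 3) + (3 / 2 * z ^ 2 + 2 * z + (-3)) := by
  refine aux_nonneg _ _ (by norm_num) (aux_quad _ _ _ _ _ _) ?_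
  refine aux_nonneg _ _ (by norm_num) (aux_quad _ _ _ _ _ _) ?_
  refine aux_nonneg _ _ (by norm_num) (aux_quad _ _ _ _ _ _) ?_
  intro x hx
  have : 0 ≤ Real.exp x * (2 * x ^ 2 + 7 * x) := by positivity
  norm_num
  linarith

theorem aux_psi : ∀ z : ℝ, 0 ≤ z → 0 ≤ z * Real.exp z - Real.exp z + 1 := by
  intro z hz
  have h := aux_nonneg (fun z => Real.exp z * (0 * z ^ 2 + 1 * z + (-1)) + (0 * z ^ 2 + 0 * z + 1)) _
    (by norm_num) (aux_quad _ _ _ _ _ _) (by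
      intro x hx
      have : 0 ≤ Real.exp x * x := by positivity
      norm_num
      linarith) z hz
  linarith

/-- Lemma 4.1 of the paper: with `ψ z = z·e^z − e^z + 1`, for every `a > 0` and `z > 0`,
`(a·ψ(z)/z²)/(1 + a·ψ(z)/z) ≤ max(a, 4/3)/2`. -/
theorem stmt_0 :
    ∀ a : ℝ, 0 < a → ∀ z : ℝ, 0 < z →
      (a * (z * Real.exp z - Real.exp z + 1) / z ^ 2) /
          (1 + a * (z * Real.exp z - Real.exp z + 1) / z) ≤ max a (4 / 3) / 2 := by
  intro a ha z hz
  have h1 := aux_pos z hz.le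
  have h2 := aux_psi z hz.le
  have h3 : (z * Real.exp z - Real.exp z + 1) * (1 - 2 * z / 3) ≤ z ^ 2 / 2 := by linarith
  generalize z * Real.exp z - Real.exp z + 1 = p at h2 h3
  have hp : 0 ≤ a * p / z := by positivity
  rw [div_le_iff₀ (by linarith), div_le_iff₀ (by positivity)]
  have e : max a (4 / 3) / 2 * (1 + a * p / z) * z ^ 2
      = max a (4 / 3) / 2 * (z ^ 2 + a * p * z) := by
    field_simp
  rw [e]
  have hzp : 0 ≤ z * p := by positivity
  rcases le_total a (4 / 3) with h | h
  · rw [max_eq_right h]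
    have := mul_le_mul_of_nonneg_left h3 ha.le
    have := mul_le_mul_of_nonneg_right h (sq_nonneg z)
    linarith
  · rw [max_eq_left h]
    have := mul_le_mul_of_nonneg_right h hzp
    have h4 : p ≤ (z ^ 2 + a * p * z) / 2 := by linarith
    have := mul_le_mul_of_nonneg_left h4 ha.le
    linarith
end

section
/- For every real number z ≥ 0, one has ψ(z)·(1 − (2/3)z) ≤ (1/2)z²; equivalently, (5/3)·z·e^z + 1 ≤ (2/3)·z²·e^z + e^z + (2/3)z + (1/2)z². -/
lemma aux_second (z : ℝ) : 0 ≤ Real.exp z * ((2/3) * z^2 + z - 1) + 1 := by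
  have h1 : 1 - z ≤ Real.exp (-z) := by linarith [Real.add_one_le_exp (-z)]
  have h2 : Real.exp z * Real.exp (-z) = 1 := by rw [← Real.exp_add]; simp
  have h3 := Real.exp_pos z
  have h4 := mul_le_mul_of_nonneg_left h1 h3.le
  have h5 : 0 ≤ Real.exp z * ((2/3) * z^2) := by positivity
  nlinarith

lemma aux_first (z : ℝ) (hz : 0 ≤ z) :
    0 ≤ Real.exp z * ((2/3) * z^2 - z/3 - 2/3) + 2/3 + z := by
  have hd : ∀ x : ℝ, HasDerivAt (fun z : ℝ => Real.exp z * ((2/3) * z^2 - z/3 - 2/3) + 2/3 + z)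
      (Real.exp x * ((2/3) * x^2 + x - 1) + 1) x := by
    intro x
    have := (((Real.hasDerivAt_exp x).mul (((((hasDerivAt_id x).pow 2).const_mul (2/3)).sub
      ((hasDerivAt_id x).div_const 3)).sub_const (2/3))).add_const (2/3)).add (hasDerivAt_id x)
    refine this.congr_deriv ?_
    simp
    ring
  have hm := monotone_of_hasDerivAt_nonneg hd (fun x => aux_second x)
  have := hm hz
  norm_num at this
  linarith

lemma aux_zero (z : ℝ) (hz : 0 ≤ z) :
    0 ≤ Real.exp z * ((2/3) * z^2 - (5/3) * z + 1) + (2/3) * z + (1/2) * z^2 - 1 := by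
  have hd : ∀ x : ℝ, HasDerivAt
      (fun z : ℝ => Real.exp z * ((2/3) * z^2 - (5/3) * z + 1) + (2/3) * z + (1/2) * z^2 - 1)
      (Real.exp x * ((2/3) * x^2 - x/3 - 2/3) + 2/3 + x) x := by
    intro x
    have := ((((Real.hasDerivAt_exp x).mul (((((hasDerivAt_id x).pow 2).const_mul (2/3)).sub
      ((hasDerivAt_id x).const_mul (5/3))).add_const 1)).add
      ((hasDerivAt_id x).const_mul (2/3))).add
      (((hasDerivAt_id x).pow 2).const_mul (1/2))).sub_const 1
    refine this.congr_deriv ?_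
    simp
    ring
  have hm := monotoneOn_of_deriv_nonneg (convex_Ici (0:ℝ))
    (fun x _ => (hd x).continuousAt.continuousWithinAt)
    (fun x _ => (hd x).differentiableAt.differentiableWithinAt)
    (fun x hx => by
      rw [(hd x).deriv]
      exact aux_first x (interior_subset hx))
  have := hm (Set.mem_Ici.2 le_rfl) (Set.mem_Ici.2 hz) hz
  norm_num at this
  linarith

/-- Inequality (4.2) in the proof of Lemma 4.1: with `ψ z = z·e^z − e^z + 1`, for `z ≥ 0`,
`ψ(z)·(1 − (2/3)z) ≤ (1/2)z²`; equivalently,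
`(5/3)·z·e^z + 1 ≤ (2/3)·z²·e^z + e^z + (2/3)z + (1/2)z²`. -/
theorem stmt_1 :
    ∀ z : ℝ, 0 ≤ z →
      (z * Real.exp z - Real.exp z + 1) * (1 - (2 / 3) * z) ≤ (1 / 2) * z ^ 2 ∧
      (5 / 3) * z * Real.exp z + 1 ≤
        (2 / 3) * z ^ 2 * Real.exp z + Real.exp z + (2 / 3) * z + (1 / 2) * z ^ 2 := by
  intro z hz
  have h := aux_zero z hz
  constructor <;> nlinarith [h]
end

section
/- Suppose c ≥ 0 is an integer such that every finite set P ⊆ S with x − y ∉ S for all distinct x, y ∈ P has cardinality |P| ≤ c. Then for every finite set ξ ⊆ ℝ^d and every point x ∈ ℝ^d, one has F(ξ ∪ {x}) ≥ F(ξ) − c; in particular the negative part of the add-one difference F(ξ ∪ {x}) − F(ξ) is at most c in absolute value. -/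
open MeasureTheory Set
open scoped ENNReal

noncomputable section

/-- The geometric graph `G_S(ξ)` on a point configuration `ξ ⊆ ℝ^d`: distinct points
`x, y` are adjacent iff `x − y ∈ S` (stated symmetrically; for `S = −S` this is the
graph of the paper). -/
def geomGraph {d : ℕ} (S : Set (EuclideanSpace ℝ (Fin d)))
    (ξ : Set (EuclideanSpace ℝ (Fin d))) : SimpleGraph ξ :=
  SimpleGraph.fromRel (fun x y => (x : EuclideanSpace ℝ (Fin d)) - y ∈ S)

/-- The set of component vertex sets of `G_S(ξ)`: subsets of `ℝ^d` that are the vertex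
sets of connected components of `G_S(ξ)`. -/
def compVS {d : ℕ} (S : Set (EuclideanSpace ℝ (Fin d)))
    (ξ : Set (EuclideanSpace ℝ (Fin d))) : Set (Set (EuclideanSpace ℝ (Fin d))) :=
  {c | ∃ v : ξ, c = Subtype.val '' {w : ξ | (geomGraph S ξ).Reachable v w}}

/-- `compCount S A k ξ` is the number `F(ξ)` of component vertex sets `𝐱` of `G_S(ξ)`
with `|𝐱| ≤ k` and `𝐱 ∈ A`. -/
def compCount {d : ℕ} (S : Set (EuclideanSpace ℝ (Fin d)))
    (A : Set (Set (EuclideanSpace ℝ (Fin d)))) (k : ℕ)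
    (ξ : Set (EuclideanSpace ℝ (Fin d))) : ℕ :=
  Set.ncard {c : Set (EuclideanSpace ℝ (Fin d)) | c ∈ compVS S ξ ∧ c.ncard ≤ k ∧ c ∈ A}

theorem aux_symm {d : ℕ} {S : Set (EuclideanSpace ℝ (Fin d))} (hS : S = -S)
    {a b : EuclideanSpace ℝ (Fin d)} (h : a - b ∈ S) : b - a ∈ S := by
  rw [hS, Set.mem_neg, neg_sub]
  exact h

theorem aux_adj {d : ℕ} {S : Set (EuclideanSpace ℝ (Fin d))} (hS : S = -S)
    {ξ : Set (EuclideanSpace ℝ (Fin d))} (a b : ξ) :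
    (geomGraph S ξ).Adj a b ↔ a ≠ b ∧ (a : EuclideanSpace ℝ (Fin d)) - b ∈ S := by
  unfold geomGraph
  rw [SimpleGraph.fromRel_adj]
  constructor
  · rintro ⟨h, h1 | h1⟩
    · exact ⟨h, h1⟩
    · exact ⟨h, aux_symm hS h1⟩
  · rintro ⟨h, h1⟩
    exact ⟨h, Or.inl h1⟩

theorem aux_keep {d : ℕ} {S : Set (EuclideanSpace ℝ (Fin d))} (hS : S = -S)
    {ξ : Set (EuclideanSpace ℝ (Fin d))} {x : EuclideanSpace ℝ (Fin d)}
    {C : Set (EuclideanSpace ℝ (Fin d))} (hC : C ∈ compVS S ξ)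
    (hn : ∀ y ∈ C, y - x ∉ S) : C ∈ compVS S (insert x ξ) := by
  obtain ⟨v, rfl⟩ := hC
  have hsub : ξ ⊆ insert x ξ := Set.subset_insert x ξ
  refine ⟨⟨v, hsub v.2⟩, ?_⟩
  ext w
  constructor
  · rintro ⟨w, hw, rfl⟩
    refine ⟨⟨w, hsub w.2⟩, ?_, rfl⟩
    let f : geomGraph S ξ →g geomGraph S (insert x ξ) :=
      { toFun := fun a => ⟨a, hsub a.2⟩
        map_rel' := by
          intro a b h
          rw [aux_adj hS] at h ⊢
          refine ⟨fun e => h.1 (Subtype.ext (Subtype.mk.inj e)), h.2⟩ }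
    exact SimpleGraph.Reachable.map f hw
  · rintro ⟨w, hw, rfl⟩
    have hw' : (geomGraph S (insert x ξ)).Reachable ⟨v, hsub v.2⟩ w := hw
    rw [SimpleGraph.reachable_iff_reflTransGen] at hw'
    induction hw' with
    | refl => exact ⟨v, SimpleGraph.Reachable.refl _, rfl⟩
    | @tail b e hb hbe ih =>
      obtain ⟨b', hb', hbb⟩ := ih ((SimpleGraph.reachable_iff_reflTransGen _ _).2 hb)
      rw [aux_adj hS] at hbe
      rcases e.2 with he | he
      · have h2 := hbe.2
        rw [he] at h2
        exact absurd h2 (hn _ ⟨b', hb', hbb⟩)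
      · refine ⟨⟨e, he⟩, ?_, rfl⟩
        refine SimpleGraph.Reachable.trans hb' (SimpleGraph.Adj.reachable ?_)
        rw [aux_adj hS]
        refine ⟨?_, by simpa [hbb] using hbe.2⟩
        rintro rfl
        exact hbe.1 (Subtype.ext hbb.symm)

theorem aux_same {d : ℕ} {S : Set (EuclideanSpace ℝ (Fin d))} (hS : S = -S)
    {ξ : Set (EuclideanSpace ℝ (Fin d))}
    {C D : Set (EuclideanSpace ℝ (Fin d))} (hC : C ∈ compVS S ξ) (hD : D ∈ compVS S ξ)
    {y z : EuclideanSpace ℝ (Fin d)} (hy : y ∈ C) (hz : z ∈ D)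
    (h : y = z ∨ y - z ∈ S) : C = D := by
  obtain ⟨v, rfl⟩ := hC
  obtain ⟨w, rfl⟩ := hD
  obtain ⟨y, hy, rfl⟩ := hy
  obtain ⟨z, hz, rfl⟩ := hz
  have hyz : (geomGraph S ξ).Reachable y z := by
    by_cases e : y = z
    · rw [e]
    · apply SimpleGraph.Adj.reachable
      rw [aux_adj hS]
      exact ⟨e, h.resolve_left fun h' => e (Subtype.ext h')⟩
  have hvw : (geomGraph S ξ).Reachable v w :=
    (SimpleGraph.Reachable.trans hy hyz).trans (SimpleGraph.Reachable.symm hz)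
  congr 1
  ext u
  exact ⟨fun h => hvw.symm.trans h, fun h => hvw.trans h⟩

theorem aux_fin {d : ℕ} (S : Set (EuclideanSpace ℝ (Fin d)))
    {ξ : Set (EuclideanSpace ℝ (Fin d))} (hξ : ξ.Finite) : (compVS S ξ).Finite := by
  refine hξ.finite_subsets.subset ?_
  rintro _ ⟨v, rfl⟩ _ ⟨w, _, rfl⟩
  exact w.2

/-- Lemma 4.4 (i), pathwise: if every `S`-separated finite subset of `S` has at most `c`
points, then adding one point to `ξ` decreases the component count `F` by at most `c`. -/
theorem stmt_5 {d : ℕ} (hd : 1 ≤ d) (S : Set (EuclideanSpace ℝ (Fin d))) (hS : S = -S)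
    (k : ℕ) (hk : 1 ≤ k) (A : Set (Set (EuclideanSpace ℝ (Fin d)))) (c : ℕ)
    (hc : ∀ P : Finset (EuclideanSpace ℝ (Fin d)), ↑P ⊆ S →
      (∀ x ∈ P, ∀ y ∈ P, x ≠ y → x - y ∉ S) → P.card ≤ c)
    (ξ : Set (EuclideanSpace ℝ (Fin d))) (hξ : ξ.Finite) (x : EuclideanSpace ℝ (Fin d)) :
    compCount S A k ξ ≤ compCount S A k (insert x ξ) + c := by
  classical
  set T := {C : Set (EuclideanSpace ℝ (Fin d)) | C ∈ compVS S ξ ∧ C.ncard ≤ k ∧ C ∈ A} with hT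
  set U := {C : Set (EuclideanSpace ℝ (Fin d)) |
    C ∈ compVS S (insert x ξ) ∧ C.ncard ≤ k ∧ C ∈ A} with hU
  change T.ncard ≤ U.ncard + c
  have hUf : U.Finite := (aux_fin S (hξ.insert x)).subset fun C h => h.1
  have hTf : T.Finite := (aux_fin S hξ).subset fun C h => h.1
  set B := {C | C ∈ T ∧ ∃ y ∈ C, y - x ∈ S} with hB
  have hBf : B.Finite := hTf.subset fun C h => h.1
  have hsub : T ⊆ U ∪ B := by
    intro C h
    by_cases hy : ∃ y ∈ C, y - x ∈ S
    · exact Or.inr ⟨h, hy⟩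
    · push Not at hy
      exact Or.inl ⟨aux_keep hS h.1 hy, h.2⟩
  have hBc : B.ncard ≤ c := by
    have hex : ∀ C, ∃ y, C ∈ B → y ∈ C ∧ y - x ∈ S := by
      intro C
      by_cases h : C ∈ B
      · obtain ⟨y, hy⟩ := h.2
        exact ⟨y, fun _ => hy⟩
      · exact ⟨0, fun h' => absurd h' h⟩
    choose f hf using hex
    have hinj : Set.InjOn (fun C => f C - x) (hBf.toFinset : Set _) := by
      intro C hC D hD h
      have hC : C ∈ B := by simpa using hC
      have hD : D ∈ B := by simpa using hD
      exact aux_same hS hC.1.1 hD.1.1 (hf C hC).1 (hf D hD).1 (Or.inl (sub_left_injective h))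
    rw [Set.ncard_eq_toFinset_card B hBf, ← Finset.card_image_of_injOn hinj]
    apply hc
    · intro p hp
      simp only [Finset.coe_image, Set.mem_image, Finset.mem_coe, Set.Finite.mem_toFinset] at hp
      obtain ⟨C, hC, rfl⟩ := hp
      exact (hf C hC).2
    · intro p hp q hq hpq hm
      simp only [Finset.mem_image, Set.Finite.mem_toFinset] at hp hq
      obtain ⟨C, hC, rfl⟩ := hp
      obtain ⟨D, hD, rfl⟩ := hq
      rw [sub_sub_sub_cancel_right] at hm
      have := aux_same hS hC.1.1 hD.1.1 (hf C hC).1 (hf D hD).1 (Or.inr hm)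
      subst this
      exact hpq rfl
  calc T.ncard ≤ (U ∪ B).ncard := Set.ncard_le_ncard hsub (hUf.union hBf)
    _ ≤ U.ncard + B.ncard := Set.ncard_union_le U B
    _ ≤ U.ncard + c := by omega

end
end

section
/- Let μ be a measure on the Borel sets of ℝ^d (extended to all subsets as an outer measure), let S be Borel measurable, and set σ = sup_{x ∈ ℝ^d} μ(S + x). Then for every finite set ξ ⊆ ℝ^d, the set {x ∈ ℝ^d : F(ξ ∪ {x}) < F(ξ)} is contained in the finite union ⋃_𝐲 ⋃_{y ∈ 𝐲} (S + y), taken over all component vertex sets 𝐲 of G_S(ξ) with |𝐲| ≤ k and 𝐲 ∈ A, and consequently its outer μ-measure is at most k·σ·F(ξ). -/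
open MeasureTheory Set
open scoped ENNReal

noncomputable section

theorem compVS_finite_aux {d : ℕ} (S : Set (EuclideanSpace ℝ (Fin d)))
    (ξ : Set (EuclideanSpace ℝ (Fin d))) (hξ : ξ.Finite) : (compVS S ξ).Finite := by
  refine hξ.finite_subsets.subset ?_
  rintro c ⟨v, rfl⟩
  rintro _ ⟨w, _, rfl⟩
  exact w.2

theorem compVS_insert_aux {d : ℕ} (S : Set (EuclideanSpace ℝ (Fin d))) (hS : S = -S)
    (ξ : Set (EuclideanSpace ℝ (Fin d))) (x : EuclideanSpace ℝ (Fin d))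
    (c : Set (EuclideanSpace ℝ (Fin d))) (hc : c ∈ compVS S ξ)
    (hx : ∀ y ∈ c, x - y ∉ S) : c ∈ compVS S (insert x ξ) := by
  obtain ⟨v, rfl⟩ := hc
  refine ⟨⟨v.1, Set.mem_insert_of_mem _ v.2⟩, ?_⟩
  ext z
  constructor
  · rintro ⟨w, hw, rfl⟩
    refine ⟨⟨w.1, Set.mem_insert_of_mem _ w.2⟩, ?_, rfl⟩
    let f : geomGraph S ξ →g geomGraph S (insert x ξ) :=
      { toFun := fun u => ⟨u.1, Set.mem_insert_of_mem _ u.2⟩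
        map_rel' := by
          intro a b hab
          simp only [geomGraph, SimpleGraph.fromRel_adj] at hab ⊢
          refine ⟨fun h => hab.1 (Subtype.ext (Subtype.mk.inj h)), hab.2⟩ }
    exact SimpleGraph.Reachable.map f hw
  · rintro ⟨w, hw, rfl⟩
    have hw' : (geomGraph S (insert x ξ)).Reachable
      ⟨v.1, Set.mem_insert_of_mem _ v.2⟩ w := hw
    rw [SimpleGraph.reachable_iff_reflTransGen] at hw'
    induction hw' with
    | refl => exact ⟨v, SimpleGraph.Reachable.refl _, rfl⟩
    | @tail b e hab hbc ih =>
      obtain ⟨u, hu, hub⟩ := ih ((SimpleGraph.reachable_iff_reflTransGen _ _).2 hab)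
      have hxu := hx u ⟨u, hu, rfl⟩
      simp only [geomGraph, SimpleGraph.fromRel_adj] at hbc
      rw [← hub] at hbc
      rcases e.2 with he | he
      · exfalso
        rw [he] at hbc
        rcases hbc.2 with h | h
        · apply hxu
          rw [hS, Set.mem_neg, neg_sub]
          exact h
        · exact hxu h
      · refine ⟨⟨e.1, he⟩, ?_, rfl⟩
        refine SimpleGraph.Reachable.trans hu (SimpleGraph.Adj.reachable ?_)
        simp only [geomGraph, SimpleGraph.fromRel_adj]
        refine ⟨fun h => hbc.1 (Subtype.ext ?_), hbc.2⟩
        rw [← hub, h]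

/-- First half of the proof of Theorem 3.4, pathwise: the set of points whose addition
decreases `F` is contained in the union of the translates `S + y` over the points `y` of
the counted component vertex sets, and hence has outer `μ`-measure at most `k·σ·F(ξ)`,
where `σ = sup_x μ(S + x)`. -/
theorem stmt_8 {d : ℕ} (hd : 1 ≤ d) (S : Set (EuclideanSpace ℝ (Fin d))) (hS : S = -S)
    (hSmeas : MeasurableSet S)
    (k : ℕ) (hk : 1 ≤ k) (A : Set (Set (EuclideanSpace ℝ (Fin d))))
    (μ : Measure (EuclideanSpace ℝ (Fin d)))
    (ξ : Set (EuclideanSpace ℝ (Fin d))) (hξ : ξ.Finite) :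
    {x : EuclideanSpace ℝ (Fin d) | compCount S A k (insert x ξ) < compCount S A k ξ} ⊆
        (⋃ c ∈ {c | c ∈ compVS S ξ ∧ c.ncard ≤ k ∧ c ∈ A}, ⋃ y ∈ c, (· + y) '' S) ∧
      μ {x : EuclideanSpace ℝ (Fin d) |
            compCount S A k (insert x ξ) < compCount S A k ξ} ≤
        (k : ℝ≥0∞) * (⨆ z : EuclideanSpace ℝ (Fin d), μ ((· + z) '' S)) *
          (compCount S A k ξ : ℝ≥0∞) := by
  have hsub : {x : EuclideanSpace ℝ (Fin d) |
      compCount S A k (insert x ξ) < compCount S A k ξ} ⊆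
        (⋃ c ∈ {c | c ∈ compVS S ξ ∧ c.ncard ≤ k ∧ c ∈ A}, ⋃ y ∈ c, (· + y) '' S) := by
    intro x hx
    by_contra hcon
    have hno : ∀ c ∈ {c | c ∈ compVS S ξ ∧ c.ncard ≤ k ∧ c ∈ A}, ∀ y ∈ c, x - y ∉ S := by
      intro c hc y hy hxy
      apply hcon
      refine Set.mem_biUnion hc (Set.mem_biUnion hy ⟨x - y, hxy, ?_⟩)
      simp
    have hx' : compCount S A k (insert x ξ) < compCount S A k ξ := hx
    refine absurd hx' (not_lt.2 ?_)
    refine Set.ncard_le_ncard ?_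
      ((compVS_finite_aux S _ (hξ.insert x)).subset (fun c hc => hc.1))
    intro c hc
    exact ⟨compVS_insert_aux S hS ξ x c hc.1 (hno c hc), hc.2⟩
  refine ⟨hsub, (measure_mono hsub).trans ?_⟩
  have hfin : {c | c ∈ compVS S ξ ∧ c.ncard ≤ k ∧ c ∈ A}.Finite :=
    (compVS_finite_aux S ξ hξ).subset (fun c hc => hc.1)
  have hone : ∀ c ∈ {c | c ∈ compVS S ξ ∧ c.ncard ≤ k ∧ c ∈ A},
      μ (⋃ y ∈ c, (· + y) '' S) ≤
        (k : ℝ≥0∞) * (⨆ z : EuclideanSpace ℝ (Fin d), μ ((· + z) '' S)) := by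
    intro c hc
    have hcf : c.Finite := by
      obtain ⟨v, rfl⟩ := hc.1
      refine hξ.subset ?_
      rintro _ ⟨w, _, rfl⟩
      exact w.2
    have h1 := measure_biUnion_finset_le (μ := μ) hcf.toFinset (fun y => (· + y) '' S)
    simp only [Set.Finite.mem_toFinset] at h1
    refine h1.trans ((Finset.sum_le_card_nsmul _ _ _
      (fun y _ => le_iSup (fun z => μ ((· + z) '' S)) y)).trans ?_)
    rw [nsmul_eq_mul, ← Set.ncard_eq_toFinset_card c hcf]
    gcongr
    exact hc.2.1
  have h2 := measure_biUnion_finset_le (μ := μ) hfin.toFinset (fun c => ⋃ y ∈ c, (· + y) '' S)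
  simp only [Set.Finite.mem_toFinset] at h2
  refine h2.trans ((Finset.sum_le_card_nsmul _ _ _
      (fun c hc => hone c (hfin.mem_toFinset.1 hc))).trans ?_)
  rw [nsmul_eq_mul, ← Set.ncard_eq_toFinset_card _ hfin, mul_comm]
  rfl
end
end

section
/- For every finite set ξ ⊆ ℝ^d one has ∑_{x ∈ ξ} (max(F(ξ) − F(ξ \ {x}), 0))² ≤ k·F(ξ). -/
open MeasureTheory Set
open scoped ENNReal

noncomputable section

theorem aux_comp_sub {d : ℕ} (S : Set (EuclideanSpace ℝ (Fin d)))
    (ξ : Set (EuclideanSpace ℝ (Fin d))) (c : Set (EuclideanSpace ℝ (Fin d)))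
    (hc : c ∈ compVS S ξ) : c ⊆ ξ := by
  obtain ⟨v, rfl⟩ := hc
  rintro _ ⟨w, _, rfl⟩
  exact w.2

theorem aux_comp_unique {d : ℕ} (S : Set (EuclideanSpace ℝ (Fin d)))
    (ξ : Set (EuclideanSpace ℝ (Fin d))) (c c' : Set (EuclideanSpace ℝ (Fin d)))
    (hc : c ∈ compVS S ξ) (hc' : c' ∈ compVS S ξ) (x : EuclideanSpace ℝ (Fin d))
    (hx : x ∈ c) (hx' : x ∈ c') : c = c' := by
  obtain ⟨v, rfl⟩ := hc
  obtain ⟨v', rfl⟩ := hc'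
  obtain ⟨w, hw, rfl⟩ := hx
  obtain ⟨w', hw', h⟩ := hx'
  obtain rfl := Subtype.ext h
  simp only [Set.mem_setOf_eq] at hw hw'
  congr 1
  ext u
  simp only [Set.mem_setOf_eq]
  exact ⟨fun h => (hw'.trans hw.symm).trans h, fun h => (hw.trans hw'.symm).trans h⟩

theorem aux_comp_remove {d : ℕ} (S : Set (EuclideanSpace ℝ (Fin d)))
    (ξ : Set (EuclideanSpace ℝ (Fin d))) (c : Set (EuclideanSpace ℝ (Fin d)))
    (hc : c ∈ compVS S ξ) (x : EuclideanSpace ℝ (Fin d)) (hx : x ∉ c) :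
    c ∈ compVS S (ξ \ {x}) := by
  obtain ⟨v, rfl⟩ := hc
  have key : ∀ w : ξ, (geomGraph S ξ).Reachable v w → (w : EuclideanSpace ℝ (Fin d)) ≠ x := by
    rintro w hw rfl
    exact hx ⟨w, hw, rfl⟩
  have hv : (v : EuclideanSpace ℝ (Fin d)) ∈ ξ \ {x} := ⟨v.2, key v (SimpleGraph.Reachable.refl v)⟩
  refine ⟨⟨v, hv⟩, ?_⟩
  ext w
  constructor
  · rintro ⟨w, hw, rfl⟩
    simp only [Set.mem_setOf_eq] at hw
    suffices h : ∃ h : (w : EuclideanSpace ℝ (Fin d)) ∈ ξ \ {x},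
        (geomGraph S (ξ \ {x})).Reachable ⟨v, hv⟩ ⟨w, h⟩ by
      obtain ⟨h, hr⟩ := h
      exact ⟨⟨w, h⟩, hr, rfl⟩
    have hw2 := (SimpleGraph.reachable_iff_reflTransGen _ _).1 hw
    clear hw
    induction hw2 with
    | refl => exact ⟨hv, SimpleGraph.Reachable.refl _⟩
    | @tail b e hb hbe ih =>
      obtain ⟨h, hr⟩ := ih
      have hbr := (SimpleGraph.reachable_iff_reflTransGen _ _).2 hb
      have he := key e (hbr.trans hbe.reachable)
      refine ⟨⟨e.2, he⟩, hr.trans (SimpleGraph.Adj.reachable ?_)⟩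
      simp only [geomGraph, SimpleGraph.fromRel_adj, ne_eq, Subtype.ext_iff] at hbe ⊢
      exact hbe
  · rintro ⟨w, hw, rfl⟩
    let f : geomGraph S (ξ \ {x}) →g geomGraph S ξ :=
      { toFun := fun u => ⟨u.1, u.2.1⟩
        map_rel' := by
          intro a b hab
          simp only [geomGraph, SimpleGraph.fromRel_adj, ne_eq, Subtype.ext_iff] at hab ⊢
          exact hab }
    exact ⟨f w, SimpleGraph.Reachable.map f hw, rfl⟩

/-- Second half of the proof of Theorem 3.4, pathwise: the sum over `x ∈ ξ` of the
squared positive part of the remove-one difference is at most `k·F(ξ)`. -/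
theorem stmt_9 {d : ℕ} (hd : 1 ≤ d) (S : Set (EuclideanSpace ℝ (Fin d))) (hS : S = -S)
    (k : ℕ) (hk : 1 ≤ k) (A : Set (Set (EuclideanSpace ℝ (Fin d))))
    (ξ : Set (EuclideanSpace ℝ (Fin d))) (hξ : ξ.Finite) :
    ∑ x ∈ hξ.toFinset,
        (max ((compCount S A k ξ : ℤ) - (compCount S A k (ξ \ {x}) : ℤ)) 0) ^ 2 ≤
      (k : ℤ) * (compCount S A k ξ : ℤ) := by
  classical
  set B : Set (EuclideanSpace ℝ (Fin d)) → Set (Set (EuclideanSpace ℝ (Fin d))) :=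
    fun η => {c | c ∈ compVS S η ∧ c.ncard ≤ k ∧ c ∈ A} with hB
  have hfin : ∀ η : Set (EuclideanSpace ℝ (Fin d)), η.Finite → (B η).Finite := fun η hη =>
    hη.finite_subsets.subset fun c hc => aux_comp_sub S η c hc.1
  have hBf := hfin ξ hξ
  have hcount : compCount S A k ξ = hBf.toFinset.card := Set.ncard_eq_toFinset_card _ hBf
  have hterm : ∀ x ∈ hξ.toFinset,
      (max ((compCount S A k ξ : ℤ) - (compCount S A k (ξ \ {x}) : ℤ)) 0) ^ 2 ≤
        ((hBf.toFinset.filter (fun c => x ∈ c)).card : ℤ) := by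
    intro x _
    have hf' := hfin (ξ \ {x}) (hξ.subset Set.diff_subset)
    have hcount' : compCount S A k (ξ \ {x}) = hf'.toFinset.card :=
      Set.ncard_eq_toFinset_card _ hf'
    have h1 : (hBf.toFinset.filter (fun c => x ∈ c)).card ≤ 1 := by
      rw [Finset.card_le_one]
      intro a ha b hb
      simp only [Finset.mem_filter, Set.Finite.mem_toFinset] at ha hb
      exact aux_comp_unique S ξ a b ha.1.1 hb.1.1 x ha.2 hb.2
    have h2 : (hBf.toFinset.filter (fun c => ¬ x ∈ c)).card ≤ hf'.toFinset.card := by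
      apply Finset.card_le_card
      intro a ha
      simp only [Finset.mem_filter, Set.Finite.mem_toFinset] at ha ⊢
      exact ⟨aux_comp_remove S ξ a ha.1.1 x ha.2, ha.1.2⟩
    have h3 := Finset.card_filter_add_card_filter_not (s := hBf.toFinset) (fun c => x ∈ c)
    rw [hcount, hcount']
    generalize (hBf.toFinset.filter (fun c => x ∈ c)).card = n at *
    have h4 : max ((hBf.toFinset.card : ℤ) - (hf'.toFinset.card : ℤ)) 0 ≤ n := by omega
    have h5 : 0 ≤ max ((hBf.toFinset.card : ℤ) - (hf'.toFinset.card : ℤ)) 0 := le_max_right _ _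
    have h6 : (n : ℤ) ≤ 1 := by exact_mod_cast h1
    nlinarith
  refine (Finset.sum_le_sum hterm).trans ?_
  rw [hcount]
  have hsum : ∑ x ∈ hξ.toFinset, (hBf.toFinset.filter (fun c => x ∈ c)).card =
      ∑ c ∈ hBf.toFinset, (hξ.toFinset.filter (fun x => x ∈ c)).card :=
    Finset.sum_card_bipartiteAbove_eq_sum_card_bipartiteBelow (fun x c => x ∈ c)
  have hle : ∑ c ∈ hBf.toFinset, (hξ.toFinset.filter (fun x => x ∈ c)).card ≤
      hBf.toFinset.card • k := by
    apply Finset.sum_le_card_nsmul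
    intro c hc
    have hc' : c ∈ B ξ := by simpa using hc
    refine le_trans (le_of_eq ?_) hc'.2.1
    rw [← Set.ncard_coe_finset]
    congr 1
    ext y
    simp only [Finset.coe_filter, Set.Finite.mem_toFinset, Set.mem_setOf_eq]
    exact ⟨fun h => h.2, fun h => ⟨aux_comp_sub S ξ c hc'.1 h, h⟩⟩
  rw [← hsum, smul_eq_mul, mul_comm] at hle
  exact_mod_cast hle

end
end

section
/- Let μ be a measure on the Borel sets of ℝ^d, let S be Borel measurable, set σ = sup_{x ∈ ℝ^d} μ(S + x), and suppose c ≥ 0 is an integer such that every finite set P ⊆ S with x − y ∉ S for all distinct x, y ∈ P has cardinality |P| ≤ c. Then for every finite set ξ ⊆ ℝ^d, the upper integral ∫ (max(F(ξ) − F(ξ ∪ {x}), 0))² dμ(x) plus the sum ∑_{x ∈ ξ} (max(F(ξ) − F(ξ \ {x}), 0))² is at most k·(c²·σ + 1)·F(ξ). -/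
open MeasureTheory Set
open scoped ENNReal

noncomputable section

theorem cvs_ne {d : ℕ} {S ξ c : Set (EuclideanSpace ℝ (Fin d))} (h : c ∈ compVS S ξ) :
    c.Nonempty := by
  obtain ⟨v, rfl⟩ := h
  exact ⟨v, v, SimpleGraph.Reachable.refl v, rfl⟩

theorem cvs_sub {d : ℕ} {S ξ c : Set (EuclideanSpace ℝ (Fin d))} (h : c ∈ compVS S ξ) :
    c ⊆ ξ := by
  obtain ⟨v, rfl⟩ := h
  rintro _ ⟨w, -, rfl⟩
  exact w.2

theorem cvs_closed {d : ℕ} {S ξ c : Set (EuclideanSpace ℝ (Fin d))} (h : c ∈ compVS S ξ)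
    {y z : EuclideanSpace ℝ (Fin d)} (hy : y ∈ c) (hz : z ∈ ξ) (hyz : y - z ∈ S) : z ∈ c := by
  by_cases hne : y = z
  · exact hne ▸ hy
  obtain ⟨v, rfl⟩ := h
  obtain ⟨w, hw, rfl⟩ := hy
  refine ⟨⟨z, hz⟩, ?_, rfl⟩
  refine SimpleGraph.Reachable.trans hw (SimpleGraph.Adj.reachable ?_)
  refine (SimpleGraph.fromRel_adj _ _ _).2 ⟨fun e => hne (congrArg Subtype.val e), Or.inl hyz⟩

theorem cvs_eq {d : ℕ} {S ξ c c' : Set (EuclideanSpace ℝ (Fin d))} (h : c ∈ compVS S ξ)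
    (h' : c' ∈ compVS S ξ) {y : EuclideanSpace ℝ (Fin d)} (hy : y ∈ c) (hy' : y ∈ c') :
    c = c' := by
  obtain ⟨v, rfl⟩ := h
  obtain ⟨v', rfl⟩ := h'
  obtain ⟨w, hw, rfl⟩ := hy
  obtain ⟨w', hw', e⟩ := hy'
  obtain rfl : w' = w := Subtype.ext e
  have hw : (geomGraph S ξ).Reachable v w' := hw
  have hw' : (geomGraph S ξ).Reachable v' w' := hw'
  congr 1
  ext u
  exact ⟨fun hu => (hw'.trans hw.symm).trans hu, fun hu => (hw.trans hw'.symm).trans hu⟩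

theorem sym_mem {d : ℕ} {S : Set (EuclideanSpace ℝ (Fin d))} (hS : S = -S)
    {y z : EuclideanSpace ℝ (Fin d)} (h : y - z ∈ S) : z - y ∈ S := by
  rw [hS, Set.mem_neg, neg_sub]
  exact h

theorem cvs_surv {d : ℕ} {S ξ ξ' c : Set (EuclideanSpace ℝ (Fin d))} (hS : S = -S)
    (h : c ∈ compVS S ξ) (hsub : c ⊆ ξ')
    (hcl : ∀ y ∈ c, ∀ z ∈ ξ', y - z ∈ S → z ∈ c) : c ∈ compVS S ξ' := by
  obtain ⟨v, hv⟩ := h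
  have hvc : (v : EuclideanSpace ℝ (Fin d)) ∈ c := by
    rw [hv]; exact ⟨v, SimpleGraph.Reachable.refl v, rfl⟩
  refine ⟨⟨v, hsub hvc⟩, ?_⟩
  apply Set.Subset.antisymm
  · have key : ∀ w : ξ, (geomGraph S ξ).Reachable v w → ∃ hw : (w : EuclideanSpace ℝ (Fin d)) ∈ ξ',
        (geomGraph S ξ').Reachable ⟨v, hsub hvc⟩ ⟨w, hw⟩ := by
      intro w hw
      rw [SimpleGraph.reachable_iff_reflTransGen] at hw
      induction hw with
      | refl => exact ⟨hsub hvc, SimpleGraph.Reachable.refl _⟩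
      | @tail a b hab hadj ih =>
        obtain ⟨ha, hr⟩ := ih
        have hb : (b : EuclideanSpace ℝ (Fin d)) ∈ c := by
          rw [hv]
          exact ⟨b, ((SimpleGraph.reachable_iff_reflTransGen _ _).2 hab).trans hadj.reachable, rfl⟩
        refine ⟨hsub hb, hr.trans (SimpleGraph.Adj.reachable ?_)⟩
        obtain ⟨hne, hor⟩ := (SimpleGraph.fromRel_adj _ _ _).1 hadj
        exact (SimpleGraph.fromRel_adj _ _ _).2
          ⟨fun e => hne (Subtype.ext (Subtype.mk.inj e)), hor⟩
    intro y hy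
    rw [hv] at hy
    obtain ⟨w, hw, rfl⟩ := hy
    obtain ⟨hw', hr⟩ := key w hw
    exact ⟨⟨w, hw'⟩, hr, rfl⟩
  · rintro _ ⟨w, hw, rfl⟩
    have hw := (SimpleGraph.reachable_iff_reflTransGen _ _).1 hw
    induction hw with
    | refl => exact hvc
    | @tail a b hab hadj ih =>
      have ha := ih ((SimpleGraph.reachable_iff_reflTransGen _ _).2 hab)
      obtain ⟨hne, hor⟩ := (SimpleGraph.fromRel_adj _ _ _).1 hadj
      exact hcl _ ha _ b.2 (hor.elim id (sym_mem hS))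

/-- counted components -/
def cntd {d : ℕ} (S : Set (EuclideanSpace ℝ (Fin d)))
    (A : Set (Set (EuclideanSpace ℝ (Fin d)))) (k : ℕ)
    (ξ : Set (EuclideanSpace ℝ (Fin d))) : Set (Set (EuclideanSpace ℝ (Fin d))) :=
  {c : Set (EuclideanSpace ℝ (Fin d)) | c ∈ compVS S ξ ∧ c.ncard ≤ k ∧ c ∈ A}

theorem cntd_fin {d : ℕ} (S : Set (EuclideanSpace ℝ (Fin d)))
    (A : Set (Set (EuclideanSpace ℝ (Fin d)))) (k : ℕ)
    {ξ : Set (EuclideanSpace ℝ (Fin d))} (hξ : ξ.Finite) : (cntd S A k ξ).Finite :=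
  hξ.finite_subsets.subset fun _ h => cvs_sub h.1

theorem cnt_diff {d : ℕ} (S : Set (EuclideanSpace ℝ (Fin d)))
    (A : Set (Set (EuclideanSpace ℝ (Fin d)))) (k : ℕ)
    {ξ ξ' : Set (EuclideanSpace ℝ (Fin d))} (hξ' : ξ'.Finite) :
    (compCount S A k ξ : ℝ≥0∞) - (compCount S A k ξ' : ℝ≥0∞) ≤
      ((cntd S A k ξ \ cntd S A k ξ').ncard : ℝ≥0∞) := by
  rw [tsub_le_iff_right]
  exact_mod_cast Set.ncard_le_ncard_sdiff_add_ncard (cntd S A k ξ) (cntd S A k ξ')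
    (cntd_fin S A k hξ')

open Classical in
/-- points lying in counted components -/
def pts {d : ℕ} (S : Set (EuclideanSpace ℝ (Fin d)))
    (A : Set (Set (EuclideanSpace ℝ (Fin d)))) (k : ℕ)
    {ξ : Set (EuclideanSpace ℝ (Fin d))} (hξ : ξ.Finite) : Finset (EuclideanSpace ℝ (Fin d)) :=
  hξ.toFinset.filter (fun y => ∃ c ∈ cntd S A k ξ, y ∈ c)

open Classical in
theorem pts_card {d : ℕ} (S : Set (EuclideanSpace ℝ (Fin d)))
    (A : Set (Set (EuclideanSpace ℝ (Fin d)))) (k : ℕ)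
    {ξ : Set (EuclideanSpace ℝ (Fin d))} (hξ : ξ.Finite) :
    (pts S A k hξ).card ≤ k * compCount S A k ξ := by
  have hf := cntd_fin S A k hξ
  have hsub : pts S A k hξ ⊆ hf.toFinset.biUnion
      (fun c => hξ.toFinset.filter (fun y => y ∈ c)) := by
    intro y hy
    simp only [pts, Finset.mem_filter] at hy
    obtain ⟨h1, c, hc, hyc⟩ := hy
    simp only [Finset.mem_biUnion, Finset.mem_filter]
    exact ⟨c, hf.mem_toFinset.2 hc, h1, hyc⟩
  refine (Finset.card_le_card hsub).trans ?_
  refine (Finset.card_biUnion_le_card_mul _ _ k ?_).trans ?_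
  · intro c hc
    have hc := hf.mem_toFinset.1 hc
    refine le_trans ?_ hc.2.1
    rw [← Set.ncard_coe_finset]
    apply Set.ncard_le_ncard
    · intro y hy
      simp at hy
      exact hy.2
    · exact hξ.subset (cvs_sub hc.1)
  · rw [mul_comm]
    apply le_of_eq
    congr 1
    exact (Set.ncard_eq_toFinset_card _ hf).symm

theorem rem_bound {d : ℕ} (S : Set (EuclideanSpace ℝ (Fin d))) (hS : S = -S)
    (A : Set (Set (EuclideanSpace ℝ (Fin d)))) (k : ℕ)
    {ξ : Set (EuclideanSpace ℝ (Fin d))} (hξ : ξ.Finite) :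
    ∑ x ∈ hξ.toFinset,
          ((compCount S A k ξ : ℝ≥0∞) - (compCount S A k (ξ \ {x}) : ℝ≥0∞)) ^ 2 ≤
      (pts S A k hξ).card := by
  classical
  have hmem : ∀ x, ∀ c ∈ cntd S A k ξ \ cntd S A k (ξ \ {x}), x ∈ c := by
    intro x c hc
    by_contra hx
    refine hc.2 ⟨cvs_surv hS hc.1.1 ?_ ?_, hc.1.2⟩
    · intro y hy
      exact ⟨cvs_sub hc.1.1 hy, fun e => hx (e ▸ hy)⟩
    · intro y hy z hz hyz
      exact cvs_closed hc.1.1 hy hz.1 hyz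
  have hpt : ∀ x ∈ hξ.toFinset,
      ((compCount S A k ξ : ℝ≥0∞) - (compCount S A k (ξ \ {x}) : ℝ≥0∞)) ^ 2 ≤
        if ∃ c ∈ cntd S A k ξ, x ∈ c then 1 else 0 := by
    intro x _
    have h := cnt_diff S A k (ξ := ξ) (ξ' := ξ \ {x}) hξ.sdiff
    split_ifs with hx
    · refine pow_le_one₀ (zero_le) (h.trans ?_)
      have : (cntd S A k ξ \ cntd S A k (ξ \ {x})).ncard ≤ 1 := by
        rw [Set.ncard_le_one ((cntd_fin S A k hξ).sdiff)]
        intro a ha b hb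
        exact cvs_eq ha.1.1 hb.1.1 (hmem x a ha) (hmem x b hb)
      exact_mod_cast this
    · have : cntd S A k ξ \ cntd S A k (ξ \ {x}) = ∅ := by
        rw [Set.eq_empty_iff_forall_notMem]
        intro c hc
        exact hx ⟨c, hc.1, hmem x c hc⟩
      rw [this] at h
      simp only [Set.ncard_empty, Nat.cast_zero, nonpos_iff_eq_zero] at h
      rw [h]; simp
  refine (Finset.sum_le_sum hpt).trans ?_
  rw [Finset.sum_boole]
  exact le_of_eq (by unfold pts; congr!)

theorem add_bound {d : ℕ} (S : Set (EuclideanSpace ℝ (Fin d))) (hS : S = -S)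
    (A : Set (Set (EuclideanSpace ℝ (Fin d)))) (k : ℕ) (c : ℕ)
    (hc : ∀ P : Finset (EuclideanSpace ℝ (Fin d)), ↑P ⊆ S →
      (∀ x ∈ P, ∀ y ∈ P, x ≠ y → x - y ∉ S) → P.card ≤ c)
    {ξ : Set (EuclideanSpace ℝ (Fin d))} (hξ : ξ.Finite) (x : EuclideanSpace ℝ (Fin d)) :
    ((compCount S A k ξ : ℝ≥0∞) - (compCount S A k (insert x ξ) : ℝ≥0∞)) ^ 2 ≤
      (c : ℝ≥0∞) ^ 2 * ∑ y ∈ pts S A k hξ, ((· + y) '' S).indicator (fun _ => (1 : ℝ≥0∞)) x := by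
  classical
  have h := cnt_diff S A k (ξ := ξ) (ξ' := insert x ξ) (hξ.insert x)
  set D := cntd S A k ξ \ cntd S A k (insert x ξ) with hD
  have hDf : D.Finite := (cntd_fin S A k hξ).sdiff
  have hmem : ∀ a ∈ D, ∃ y ∈ a, y - x ∈ S := by
    intro a ha
    by_contra! hx
    refine ha.2 ⟨cvs_surv hS ha.1.1 ?_ ?_, ha.1.2⟩
    · exact (cvs_sub ha.1.1).trans (Set.subset_insert _ _)
    · intro y hy z hz hyz
      rcases hz with rfl | hz
      · exact absurd hyz (hx y hy)
      · exact cvs_closed ha.1.1 hy hz hyz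
  choose! f hf hfS using hmem
  have hcard : D.ncard ≤ c := by
    rw [Set.ncard_eq_toFinset_card _ hDf]
    have hinj : Set.InjOn (fun a => f a - x) (hDf.toFinset : Set _) := by
      intro a ha b hb e
      have ha : a ∈ D := hDf.mem_toFinset.1 ha
      have hb : b ∈ D := hDf.mem_toFinset.1 hb
      have e : f a = f b := sub_left_injective e
      exact cvs_eq ha.1.1 hb.1.1 (hf a ha) (e ▸ hf b hb)
    rw [← Finset.card_image_of_injOn hinj]
    apply hc
    · intro p hp
      simp only [Finset.coe_image, Set.mem_image, Finset.mem_coe, Set.Finite.mem_toFinset] at hp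
      obtain ⟨a, ha, rfl⟩ := hp
      exact hfS a ha
    · intro p hp q hq hpq hmS
      simp only [Finset.mem_image, Set.Finite.mem_toFinset] at hp hq
      obtain ⟨a, ha, rfl⟩ := hp
      obtain ⟨b, hb, rfl⟩ := hq
      rw [sub_sub_sub_cancel_right] at hmS
      have := cvs_closed ha.1.1 (hf a ha) (cvs_sub hb.1.1 (hf b hb)) hmS
      have e := cvs_eq ha.1.1 hb.1.1 this (hf b hb)
      exact hpq (by rw [e])
  rcases D.eq_empty_or_nonempty with hE | ⟨a, ha⟩
  · rw [hE] at h
    simp only [Set.ncard_empty, Nat.cast_zero, nonpos_iff_eq_zero] at h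
    rw [h]; simp
  · have h1 : (1 : ℝ≥0∞) ≤
        ∑ y ∈ pts S A k hξ, ((· + y) '' S).indicator (fun _ => (1 : ℝ≥0∞)) x := by
      have hmemp : f a ∈ pts S A k hξ := by
        simp only [pts, Finset.mem_filter, Set.Finite.mem_toFinset]
        exact ⟨cvs_sub ha.1.1 (hf a ha), a, ha.1, hf a ha⟩
      refine le_trans ?_ (Finset.single_le_sum (fun _ _ => zero_le) hmemp)
      rw [Set.indicator_of_mem]
      exact ⟨x - f a, sym_mem hS (hfS a ha), by simp⟩
    calc _ ≤ (c : ℝ≥0∞) ^ 2 := by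
          gcongr
          exact h.trans (by exact_mod_cast hcard)
      _ = (c : ℝ≥0∞) ^ 2 * 1 := (mul_one _).symm
      _ ≤ _ := by gcongr

/-- Theorem 3.4 of the paper, pathwise: the self-bounding inequality. The (upper)
integral of the squared negative part of the add-one difference plus the sum over
`x ∈ ξ` of the squared positive part of the remove-one difference is at most
`k·(c²·σ + 1)·F(ξ)`, where `σ = sup_x μ(S + x)`. (In `ℝ≥0∞`, the truncated difference
`F(ξ) - F(ξ ∪ {x})` is exactly `max(F(ξ) − F(ξ ∪ {x}), 0)`.) -/
theorem stmt_10 {d : ℕ} (hd : 1 ≤ d) (S : Set (EuclideanSpace ℝ (Fin d))) (hS : S = -S)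
    (hSmeas : MeasurableSet S)
    (k : ℕ) (hk : 1 ≤ k) (A : Set (Set (EuclideanSpace ℝ (Fin d))))
    (μ : Measure (EuclideanSpace ℝ (Fin d))) (c : ℕ)
    (hc : ∀ P : Finset (EuclideanSpace ℝ (Fin d)), ↑P ⊆ S →
      (∀ x ∈ P, ∀ y ∈ P, x ≠ y → x - y ∉ S) → P.card ≤ c)
    (ξ : Set (EuclideanSpace ℝ (Fin d))) (hξ : ξ.Finite) :
    (∫⁻ x, ((compCount S A k ξ : ℝ≥0∞) - (compCount S A k (insert x ξ) : ℝ≥0∞)) ^ 2 ∂μ) +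
        ∑ x ∈ hξ.toFinset,
          ((compCount S A k ξ : ℝ≥0∞) - (compCount S A k (ξ \ {x}) : ℝ≥0∞)) ^ 2 ≤
      (k : ℝ≥0∞) * ((c : ℝ≥0∞) ^ 2 * (⨆ z : EuclideanSpace ℝ (Fin d), μ ((· + z) '' S)) + 1) *
        (compCount S A k ξ : ℝ≥0∞) := by
  set σ := ⨆ z : EuclideanSpace ℝ (Fin d), μ ((· + z) '' S) with hσ
  have hcard : ((pts S A k hξ).card : ℝ≥0∞) ≤ k * compCount S A k ξ := by
    exact_mod_cast pts_card S A k hξ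
  have hm : ∀ y : EuclideanSpace ℝ (Fin d), MeasurableSet ((· + y) '' S) := fun y =>
    (measurableEmbedding_addRight y).measurableSet_image.2 hSmeas
  have hI : (∫⁻ x, ((compCount S A k ξ : ℝ≥0∞) -
      (compCount S A k (insert x ξ) : ℝ≥0∞)) ^ 2 ∂μ) ≤
        (c : ℝ≥0∞) ^ 2 * ((pts S A k hξ).card * σ) := by
    refine (lintegral_mono (add_bound S hS A k c hc hξ)).trans ?_
    rw [lintegral_const_mul' _ _ (by simp),
      lintegral_finsetSum _ (fun y _ => measurable_const.indicator (hm y))]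
    gcongr
    rw [← nsmul_eq_mul]
    apply Finset.sum_le_card_nsmul
    intro y _
    rw [lintegral_indicator_const (hm y), one_mul]
    exact le_iSup (fun z : EuclideanSpace ℝ (Fin d) => μ ((· + z) '' S)) y
  calc _ ≤ (c : ℝ≥0∞) ^ 2 * ((pts S A k hξ).card * σ) + (pts S A k hξ).card :=
        add_le_add hI (rem_bound S hS A k hξ)
    _ ≤ (c : ℝ≥0∞) ^ 2 * ((k * compCount S A k ξ) * σ) + k * compCount S A k ξ := by gcongr
    _ = _ := by ring

end
end

section
/- Let d ≥ 1 and k ≥ 1 be integers, let r > 0, let S ⊆ ℝ^d be a Borel set with S = −S and S ⊆ B(0, r), and let m : ℝ^d → [0, ∞) be measurable with ∫_{ℝ^d} m(x)^k dx < ∞. Then ∫_{(ℝ^d)^k} 1{the graph on {1, …, k} with edge i ∼ j iff x_i − x_j ∈ S is connected} · ∏_{i=1}^k m(x_i) d(x₁, …, x_k) ≤ k · λ(B(0, (k−1)r))^{k−1} · ∫_{ℝ^d} m(x)^k dx < ∞, where λ denotes Lebesgue measure on ℝ^d and B(0, s) the closed Euclidean ball of radius s. -/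
open MeasureTheory
open scoped ENNReal NNReal

lemma walk_dist_le {d k : ℕ} {r : ℝ}
    {S : Set (EuclideanSpace ℝ (Fin d))}
    (hSr : S ⊆ Metric.closedBall (0 : EuclideanSpace ℝ (Fin d)) r)
    (x : Fin k → EuclideanSpace ℝ (Fin d)) {u v : Fin k}
    (w : (SimpleGraph.fromRel (fun i j : Fin k => x i - x j ∈ S)).Walk u v) :
    dist (x u) (x v) ≤ w.length * r := by
  induction w with
  | nil => simp
  | @cons a b c h p ih =>
    have h1 : dist (x a) (x b) ≤ r := by
      rw [SimpleGraph.fromRel_adj] at h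
      rcases h.2 with h | h
      · have := hSr h
        rwa [mem_closedBall_zero_iff, ← dist_eq_norm] at this
      · have := hSr h
        rwa [mem_closedBall_zero_iff, ← dist_eq_norm, dist_comm] at this
    have h2 := dist_triangle (x a) (x b) (x c)
    rw [SimpleGraph.Walk.length_cons]
    push_cast
    linarith

lemma connected_dist_le {d n : ℕ} {r : ℝ} (hr : 0 < r)
    {S : Set (EuclideanSpace ℝ (Fin d))}
    (hSr : S ⊆ Metric.closedBall (0 : EuclideanSpace ℝ (Fin d)) r)
    (x : Fin (n + 1) → EuclideanSpace ℝ (Fin d))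
    (hx : (SimpleGraph.fromRel (fun i j : Fin (n + 1) => x i - x j ∈ S)).Connected)
    (u v : Fin (n + 1)) : dist (x u) (x v) ≤ n * r := by
  obtain ⟨p, hp⟩ := (hx.preconnected u v).exists_isPath
  have h1 := walk_dist_le hSr x p
  have h2 := hp.length_lt
  rw [Fintype.card_fin] at h2
  have h3 : (p.length : ℝ) ≤ n := by exact_mod_cast Nat.lt_succ_iff.mp h2
  nlinarith

lemma ballSet_meas (d n : ℕ) (R : ℝ) :
    MeasurableSet {p : EuclideanSpace ℝ (Fin d) × (Fin n → EuclideanSpace ℝ (Fin d)) |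
      ∀ j, dist (p.2 j) p.1 ≤ R} := by
  rw [Set.setOf_forall]
  refine MeasurableSet.iInter fun j => ?_
  exact (isClosed_le (by fun_prop) continuous_const).measurableSet

lemma term_meas {d n : ℕ} (R : ℝ) (f : EuclideanSpace ℝ (Fin d) → ℝ≥0∞) (hf : Measurable f) :
    Measurable (fun p : EuclideanSpace ℝ (Fin d) × (Fin n → EuclideanSpace ℝ (Fin d)) =>
      Set.indicator {p : EuclideanSpace ℝ (Fin d) × (Fin n → EuclideanSpace ℝ (Fin d)) |
      ∀ j, dist (p.2 j) p.1 ≤ R} (fun p => f p.1) p) :=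
  (hf.comp measurable_fst).indicator (ballSet_meas d n R)

lemma term_lintegral {d n : ℕ} (R : ℝ) (f : EuclideanSpace ℝ (Fin d) → ℝ≥0∞)
    (hf : Measurable f) :
    ∫⁻ p : EuclideanSpace ℝ (Fin d) × (Fin n → EuclideanSpace ℝ (Fin d)),
      Set.indicator {p : EuclideanSpace ℝ (Fin d) × (Fin n → EuclideanSpace ℝ (Fin d)) |
      ∀ j, dist (p.2 j) p.1 ≤ R} (fun p => f p.1) p =
    (volume (Metric.closedBall (0 : EuclideanSpace ℝ (Fin d)) R)) ^ n * ∫⁻ y, f y := by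
  rw [Measure.volume_eq_prod, lintegral_prod _ (term_meas R f hf).aemeasurable,
    ← lintegral_const_mul _ hf]
  refine lintegral_congr fun a => ?_
  have hB : MeasurableSet
      (Set.univ.pi fun _ : Fin n => Metric.closedBall a R) :=
    MeasurableSet.univ_pi fun _ => Metric.isClosed_closedBall.measurableSet
  have : ∀ y : Fin n → EuclideanSpace ℝ (Fin d),
      Set.indicator {p : EuclideanSpace ℝ (Fin d) × (Fin n → EuclideanSpace ℝ (Fin d)) |
        ∀ j, dist (p.2 j) p.1 ≤ R} (fun p => f p.1) (a, y) =
      Set.indicator (Set.univ.pi fun _ : Fin n => Metric.closedBall a R) (fun _ => f a) y := by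
    intro y
    simp only [Set.indicator, Set.mem_setOf_eq, Set.mem_pi, Set.mem_univ, true_implies,
      Metric.mem_closedBall]
  simp_rw [this]
  rw [lintegral_indicator_const hB, volume_pi_pi]
  simp only [Measure.addHaar_closedBall_center, Finset.prod_const, Finset.card_univ,
    Fintype.card_fin]
  rw [mul_comm]

/-- The integral estimate of Proposition 3.7: the integral over `(ℝ^d)^k` of the product
density `∏ m(x_i)` restricted to connected configurations is bounded by
`k · λ(B(0,(k−1)r))^{k−1} · ∫ m^k`, which is finite. -/
theorem stmt_12 {d k : ℕ} (hd : 1 ≤ d) (hk : 1 ≤ k) (r : ℝ) (hr : 0 < r)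
    (S : Set (EuclideanSpace ℝ (Fin d))) (hSmeas : MeasurableSet S) (hS : S = -S)
    (hSr : S ⊆ Metric.closedBall (0 : EuclideanSpace ℝ (Fin d)) r)
    (m : EuclideanSpace ℝ (Fin d) → ℝ≥0) (hm : Measurable m)
    (hint : ∫⁻ y, (m y : ℝ≥0∞) ^ k < ⊤) :
    (∫⁻ x : Fin k → EuclideanSpace ℝ (Fin d),
        Set.indicator
          {x : Fin k → EuclideanSpace ℝ (Fin d) |
            (SimpleGraph.fromRel (fun i j : Fin k => x i - x j ∈ S)).Connected}
          (fun x => ∏ i, (m (x i) : ℝ≥0∞)) x) ≤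
      (k : ℝ≥0∞) *
        (volume (Metric.closedBall (0 : EuclideanSpace ℝ (Fin d)) (((k : ℝ) - 1) * r))) ^
          (k - 1) * ∫⁻ y, (m y : ℝ≥0∞) ^ k ∧
    (k : ℝ≥0∞) *
        (volume (Metric.closedBall (0 : EuclideanSpace ℝ (Fin d)) (((k : ℝ) - 1) * r))) ^
          (k - 1) * (∫⁻ y, (m y : ℝ≥0∞) ^ k) < ⊤ := by
  obtain ⟨n, rfl⟩ : ∃ n, k = n + 1 := ⟨k - 1, by omega⟩
  have hR : (((n + 1 : ℕ) : ℝ) - 1) * r = n * r := by push_cast; ring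
  rw [hR, Nat.add_sub_cancel]
  refine ⟨?_, ?_⟩
  swap
  · exact ENNReal.mul_lt_top (ENNReal.mul_lt_top (ENNReal.natCast_lt_top _)
      (ENNReal.pow_lt_top measure_closedBall_lt_top)) hint
  have hf : Measurable (fun y => (m y : ℝ≥0∞) ^ (n + 1)) := by fun_prop
  let G : EuclideanSpace ℝ (Fin d) × (Fin n → EuclideanSpace ℝ (Fin d)) → ℝ≥0∞ := fun p =>
      Set.indicator {p : EuclideanSpace ℝ (Fin d) × (Fin n → EuclideanSpace ℝ (Fin d)) |
      ∀ j, dist (p.2 j) p.1 ≤ n * r} (fun p => (m p.1 : ℝ≥0∞) ^ (n + 1)) p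
  have hG : Measurable G := term_meas (n * r) _ hf
  have hGi := term_lintegral (n := n) (n * r) _ hf
  let e := fun i : Fin (n + 1) =>
    MeasurableEquiv.piFinSuccAbove (fun _ => EuclideanSpace ℝ (Fin d)) i
  calc _ ≤ ∫⁻ x : Fin (n + 1) → EuclideanSpace ℝ (Fin d), ∑ i, G (e i x) := by
        refine lintegral_mono fun x => ?_
        refine Set.indicator_apply_le' (fun hx => ?_) (fun _ => by positivity)
        obtain ⟨i, -, hi⟩ := Finset.exists_max_image Finset.univ (fun i => m (x i))
          Finset.univ_nonempty
        refine le_trans ?_ (Finset.single_le_sum (N := ℝ≥0∞) (f := fun i => G (e i x))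
          (fun _ _ => by positivity) (Finset.mem_univ i))
        have hmem : e i x ∈ {p : EuclideanSpace ℝ (Fin d) ×
            (Fin n → EuclideanSpace ℝ (Fin d)) | ∀ j, dist (p.2 j) p.1 ≤ n * r} := by
          intro j
          exact connected_dist_le hr hSr x hx (i.succAbove j) i
        have hGe : G (e i x) = (m (x i) : ℝ≥0∞) ^ (n + 1) := Set.indicator_of_mem hmem _
        simp only [hGe]
        calc _ ≤ ∏ _j : Fin (n + 1), (m (x i) : ℝ≥0∞) := by
              refine Finset.prod_le_prod' fun j _ => ?_
              exact_mod_cast hi j (Finset.mem_univ j)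
          _ = _ := by simp
    _ = ∑ i, ∫⁻ x : Fin (n + 1) → EuclideanSpace ℝ (Fin d), G (e i x) :=
        lintegral_finsetSum _ fun i _ => hG.comp (e i).measurable
    _ = ∑ i : Fin (n + 1), ∫⁻ p, G p := by
        refine Finset.sum_congr rfl fun i _ => ?_
        exact (volume_preserving_piFinSuccAbove
          (fun _ => EuclideanSpace ℝ (Fin d)) i).lintegral_comp hG
    _ = _ := by
        rw [hGi]
        simp [mul_assoc]
end

section
/- Let F be a bounded real random variable on a probability space and define h(u) = u^{−1}·log E[e^{uF}] for u ≠ 0. Then h is differentiable at every u ≠ 0 with h'(u) = Ent(e^{uF})/(u²·E[e^{uF}]), where Ent(Z) = E[Z·log Z] − E[Z]·log(E[Z]) for a positive integrable random variable Z with Z·log Z integrable; moreover h(u) → E[F] as u → 0. -/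
open MeasureTheory Filter
open scoped Topology

/-- The differential identity (4.3) of the Herbst argument: for a bounded random
variable `F`, the function `h(u) = u⁻¹ log E[e^{uF}]` is differentiable at every `u ≠ 0`
with `h'(u) = Ent(e^{uF})/(u² E[e^{uF}])`, where `Ent(Z) = E[Z log Z] − E[Z] log E[Z]`;
moreover `h(u) → E[F]` as `u → 0`. -/
theorem stmt_19 {Ω : Type*} [MeasurableSpace Ω] (μ : Measure Ω) [IsProbabilityMeasure μ]
    (F : Ω → ℝ) (hFmeas : Measurable F) (M : ℝ) (hFbdd : ∀ ω, |F ω| ≤ M) :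
    (∀ u : ℝ, u ≠ 0 →
      HasDerivAt (fun u : ℝ => u⁻¹ * Real.log (∫ ω, Real.exp (u * F ω) ∂μ))
        (((∫ ω, Real.exp (u * F ω) * Real.log (Real.exp (u * F ω)) ∂μ) -
            (∫ ω, Real.exp (u * F ω) ∂μ) * Real.log (∫ ω, Real.exp (u * F ω) ∂μ)) /
          (u ^ 2 * ∫ ω, Real.exp (u * F ω) ∂μ)) u) ∧
    Tendsto (fun u : ℝ => u⁻¹ * Real.log (∫ ω, Real.exp (u * F ω) ∂μ))
      (𝓝[≠] (0 : ℝ)) (𝓝 (∫ ω, F ω ∂μ)) := by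
  have hint : ∀ t : ℝ, Integrable (fun ω => Real.exp (t * F ω)) μ := by
    intro t
    refine Integrable.of_bound (by fun_prop) (Real.exp (|t| * M)) (Eventually.of_forall ?_)
    intro ω
    rw [Real.norm_eq_abs, Real.abs_exp, Real.exp_le_exp]
    calc t * F ω ≤ |t * F ω| := le_abs_self _
      _ = |t| * |F ω| := abs_mul _ _
      _ ≤ |t| * M := by gcongr; exact hFbdd ω
  have hset : ∀ t : ℝ, t ∈ interior (ProbabilityTheory.integrableExpSet F μ) := by
    intro t
    have : ProbabilityTheory.integrableExpSet F μ = Set.univ :=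
      Set.eq_univ_of_forall fun t => hint t
    simp [this]
  have hpos : ∀ t : ℝ, 0 < ∫ ω, Real.exp (t * F ω) ∂μ := fun t =>
    integral_exp_pos (hint t)
  have hd : ∀ t : ℝ, HasDerivAt (fun u : ℝ => ∫ ω, Real.exp (u * F ω) ∂μ)
      (∫ ω, F ω * Real.exp (t * F ω) ∂μ) t := fun t =>
    ProbabilityTheory.hasDerivAt_mgf (hset t)
  have hl : ∀ t : ℝ, HasDerivAt (fun u : ℝ => Real.log (∫ ω, Real.exp (u * F ω) ∂μ))
      ((∫ ω, F ω * Real.exp (t * F ω) ∂μ) / ∫ ω, Real.exp (t * F ω) ∂μ) t := fun t =>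
    (hd t).log (hpos t).ne'
  refine ⟨fun u hu => ?_, ?_⟩
  · have h1 := (hasDerivAt_inv hu).mul (hl u)
    have h2 : (∫ ω, Real.exp (u * F ω) * Real.log (Real.exp (u * F ω)) ∂μ)
        = u * ∫ ω, F ω * Real.exp (u * F ω) ∂μ := by
      rw [← integral_const_mul]
      congr 1
      funext ω
      rw [Real.log_exp]
      ring
    rw [h2]
    refine h1.congr_deriv ?_
    have := (hpos u).ne'
    field_simp
    ring
  · have h := (hasDerivAt_iff_tendsto_slope_zero.mp (hl 0))
    simpa using h
end
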